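/- Let N_U(B) denote half the number of primitive vectors t ∈ ℤ^4 with max_{1≤i≤4}|t_i| ≤ B satisfying t_1t_2(t_1+t_2) = t_3^2 t_4 and t_3 t_4 ≠ 0. For v ∈ ℝ and s, u, y ∈ ℝ^3 set Ψ(v,s,u,y) := max{ |s_1s_2s_3|, |u_1^2u_2^2u_3^2 v^3 y_1y_2y_3|, |s_1 u_1^2 u_2 u_3 v^2 y_1^2|, |s_2 u_1 u_2^2 u_3 v^2 y_2^2| }. Then N_U(B) = 2·#{ (v, s_1,s_2,s_3, u_1,u_2,u_3, y_1,y_2,y_3) ∈ ℕ^4 × ℤ^3 × ℕ^3 : v, s_1, s_2, s_3, y_1, y_2, y_3 > 0; u_3 > 0; Ψ(v,s,u,y) ≤ B; s_1u_1y_1^2 + s_2u_2y_2^2 + s_3u_3y_3^2 = 0; u_1u_2u_3 is a nonzero squarefree integer; gcd(s_1s_2s_3, u_1u_2u_3·v) = 1; gcd(y_i, y_j) = 1 for all i ≠ j; and gcd(y_i, s_j, s_k) = 1 for every permutation {i,j,k} of {1,2,3} }. -/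

import Mathlib

theorem Nat.eq_and_eq_of_squarefree_mul_sq_eq {a b x y : ℕ} (ha : Squarefree a)
    (hb : Squarefree b) (hx : 0 < x) (hy : 0 < y) (h : a * x ^ 2 = b * y ^ 2) :
    a = b ∧ x = y := by
  have key : ∀ {a b x y : ℕ}, Squarefree a → Squarefree b → 0 < x → a * x ^ 2 = b * y ^ 2 →
      a ∣ b := by
    intro a b x y ha hb hx h
    have h1 : x ^ 2 ∣ (b * y) ^ 2 := ⟨a * b, by linear_combination b * h.symm⟩
    obtain ⟨k, hk⟩ := (Nat.pow_dvd_pow_iff two_ne_zero).1 h1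
    have h2 : a * b = k ^ 2 := by
      have : x ^ 2 * (a * b) = x ^ 2 * k ^ 2 := by
        rw [← mul_pow, ← hk]; linear_combination b * h
      exact Nat.eq_of_mul_eq_mul_left (by positivity) this
    obtain ⟨m, rfl⟩ := (ha.dvd_pow_iff_dvd two_ne_zero).1 (Dvd.intro _ h2)
    have ha0 : 0 < a := Nat.pos_of_ne_zero ha.ne_zero
    exact ⟨m ^ 2, Nat.eq_of_mul_eq_mul_left ha0 (by linear_combination h2)⟩
  have hab : a = b := Nat.dvd_antisymm (key ha hb hx h) (key hb ha hy h.symm)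
  subst hab
  refine ⟨rfl, ?_⟩
  have := Nat.eq_of_mul_eq_mul_left (Nat.pos_of_ne_zero ha.ne_zero) h
  exact (Nat.pow_left_injective two_ne_zero) this

/-- Torsor coordinates for the absolute values `d b₁, d b₂, d b₃` of `t₁, t₂, -(t₁ + t₂)`. -/
theorem Nat.exists_torsor_coordinates {b₁ b₂ b₃ d t n : ℕ} (h₁₂ : b₁.Coprime b₂)
    (h₁₃ : b₁.Coprime b₃) (h₂₃ : b₂.Coprime b₃) (ht : 0 < t) (hn : 0 < n)
    (h : d ^ 3 * (b₁ * b₂ * b₃) = t ^ 2 * n)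
    (hp : ∀ p : ℕ, p.Prime → p ∣ d → p ∣ t → p ∣ n → False) :
    ∃ v s₁ s₂ s₃ u₁ u₂ u₃ y₁ y₂ y₃ : ℕ,
      d * b₁ = u₁ * u₂ * u₃ * v ^ 2 * s₁ * u₁ * y₁ ^ 2 ∧
      d * b₂ = u₁ * u₂ * u₃ * v ^ 2 * s₂ * u₂ * y₂ ^ 2 ∧
      d * b₃ = u₁ * u₂ * u₃ * v ^ 2 * s₃ * u₃ * y₃ ^ 2 ∧
      t = (u₁ * u₂ * u₃) ^ 2 * v ^ 3 * (y₁ * y₂ * y₃) ∧ n = s₁ * s₂ * s₃ ∧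
      Squarefree (u₁ * u₂ * u₃) ∧ (s₁ * s₂ * s₃).Coprime (u₁ * u₂ * u₃ * v) ∧
      y₁.Coprime y₂ ∧ y₁.Coprime y₃ ∧ y₂.Coprime y₃ ∧
      y₁.Coprime (s₂.gcd s₃) ∧ y₂.Coprime (s₁.gcd s₃) ∧ y₃.Coprime (s₁.gcd s₂) := by
  obtain ⟨d₁, d₂, hd₁, hd₂, rfl⟩ := exists_dvd_and_dvd_of_dvd_mul
    (show d ∣ t ^ 2 * n from ⟨d ^ 2 * (b₁ * b₂ * b₃), by linear_combination -h⟩)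
  have hd₁n : d₁.Coprime n := Nat.Coprime.symm <| Nat.coprime_of_dvd fun p hpp hpn hpd =>
    hp p hpp (hpd.mul_right _) (hpp.dvd_of_dvd_pow (hpd.trans hd₁)) hpn
  have hd₂t : d₂.Coprime t := Nat.Coprime.symm <| Nat.coprime_of_dvd fun p hpp hpt hpd =>
    hp p hpp (hpd.mul_left _) hpt (hpd.trans hd₂)
  have hd₁0 : 0 < d₁ := Nat.pos_of_dvd_of_pos hd₁ (by positivity)
  have hd₂0 : 0 < d₂ := Nat.pos_of_dvd_of_pos hd₂ hn
  obtain ⟨m, rfl⟩ : d₂ ^ 3 ∣ n :=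
    (Nat.Coprime.pow 3 2 hd₂t).dvd_of_dvd_mul_left
      ⟨d₁ ^ 3 * (b₁ * b₂ * b₃), by linear_combination -h⟩
  have hm : d₁ ^ 3 * (b₁ * b₂ * b₃) = t ^ 2 * m :=
    Nat.eq_of_mul_eq_mul_left (show 0 < d₂ ^ 3 by positivity) (by linear_combination h)
  obtain ⟨e₁₂, e₃, he₁₂, ⟨f₃, rfl⟩, rfl⟩ := exists_dvd_and_dvd_of_dvd_mul
    (((hd₁n.coprime_mul_left_right).pow_left 3).symm.dvd_of_dvd_mul_left
      (Dvd.intro_left _ hm.symm))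
  obtain ⟨e₁, e₂, ⟨f₁, rfl⟩, ⟨f₂, rfl⟩, rfl⟩ := exists_dvd_and_dvd_of_dvd_mul he₁₂
  have he : 0 < e₁ * e₂ * e₃ := Nat.pos_of_mul_pos_left hn
  have hf : d₁ ^ 3 * (f₁ * f₂ * f₃) = t ^ 2 :=
    Nat.eq_of_mul_eq_mul_left he (by linear_combination hm)
  obtain ⟨U, v, rfl, hU⟩ := Nat.sq_mul_squarefree d₁
  have hU0 : 0 < U := Nat.pos_of_ne_zero hU.ne_zero
  have hv0 : 0 < v := Nat.pos_of_ne_zero fun h0 => by simp [h0] at hd₁0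
  obtain ⟨w, rfl⟩ : v ^ 3 * U ∣ t := (Nat.pow_dvd_pow_iff two_ne_zero).1
    ⟨U * (f₁ * f₂ * f₃), by linear_combination -hf⟩
  have hw : U * (f₁ * f₂ * f₃) = w ^ 2 :=
    Nat.eq_of_mul_eq_mul_left (show 0 < (v ^ 3 * U) ^ 2 by positivity) (by linear_combination hf)
  obtain ⟨z, rfl⟩ := (hU.dvd_pow_iff_dvd two_ne_zero).1 (Dvd.intro _ hw)
  have hz : f₁ * f₂ * f₃ = U * z ^ 2 :=
    Nat.eq_of_mul_eq_mul_left hU0 (by linear_combination hw)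
  obtain ⟨u₁₂, u₃, hu₁₂, ⟨g₃, rfl⟩, rfl⟩ := exists_dvd_and_dvd_of_dvd_mul (Dvd.intro _ hz.symm)
  obtain ⟨u₁, u₂, ⟨g₁, rfl⟩, ⟨g₂, rfl⟩, rfl⟩ := exists_dvd_and_dvd_of_dvd_mul hu₁₂
  have hg : g₁ * g₂ * g₃ = z ^ 2 :=
    Nat.eq_of_mul_eq_mul_left hU0 (by linear_combination hz)
  simp only [Nat.coprime_mul_iff_left, Nat.coprime_mul_iff_right] at h₁₂ h₁₃ h₂₃ hd₂t hd₁n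
  have isSquare : ∀ {a b c : ℕ}, a.Coprime b → a.Coprime c → a * b * c = z ^ 2 →
      ∃ y, a = y ^ 2 := fun hab hac h =>
    exists_eq_pow_of_mul_eq_pow (Nat.isUnit_iff.2 (Nat.Coprime.mul_right hab hac))
      ((mul_assoc _ _ _).symm.trans h)
  obtain ⟨y₁, rfl⟩ := isSquare h₁₂.2.2.2.2 h₁₃.2.2.2.2 hg
  obtain ⟨y₂, rfl⟩ := isSquare h₁₂.2.2.2.2.symm h₂₃.2.2.2.2 (by linear_combination hg)
  obtain ⟨y₃, rfl⟩ := isSquare h₁₃.2.2.2.2.symm h₂₃.2.2.2.2.symm (by linear_combination hg)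
  obtain rfl : y₁ * y₂ * y₃ = z :=
    Nat.pow_left_injective two_ne_zero (by linear_combination hg)
  simp only [Nat.coprime_pow_left_iff two_pos, Nat.coprime_pow_right_iff two_pos,
    Nat.coprime_pow_right_iff three_pos,
    Nat.coprime_mul_iff_right] at h₁₂ h₁₃ h₂₃ hd₂t hd₁n
  refine ⟨v, d₂ * e₁, d₂ * e₂, d₂ * e₃, u₁, u₂, u₃, y₁, y₂, y₃, by ring, by ring, by ring, by ring,
    by ring, hU, ?_, by tauto, by tauto, by tauto, ?_, ?_, ?_⟩
  · simp only [Nat.coprime_mul_iff_left, Nat.coprime_mul_iff_right]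
    simp only [Nat.coprime_comm] at *
    tauto
  · refine Nat.Coprime.coprime_dvd_right (Nat.gcd_dvd_left _ _) (Nat.Coprime.mul_right ?_ ?_)
    · exact hd₂t.2.2.1.1.symm
    · tauto
  · refine Nat.Coprime.coprime_dvd_right (Nat.gcd_dvd_left _ _) (Nat.Coprime.mul_right ?_ ?_)
    · exact hd₂t.2.2.1.2.symm
    · exact h₁₂.2.2.1.symm
  · refine Nat.Coprime.coprime_dvd_right (Nat.gcd_dvd_left _ _) (Nat.Coprime.mul_right ?_ ?_)
    · exact hd₂t.2.2.2.symm
    · exact h₁₃.2.2.1.symm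

theorem Fin.dvd_mul_mul {R : Type*} [CommMonoid R] (f : Fin 3 → R) (i : Fin 3) :
    f i ∣ f 0 * f 1 * f 2 :=
  Fin.prod_univ_three f ▸ Finset.dvd_prod_of_mem f (Finset.mem_univ i)

theorem Fin.mul_dvd_mul_mul {R : Type*} [CommMonoid R] (f : Fin 3 → R) {i j : Fin 3}
    (hij : i ≠ j) : f i * f j ∣ f 0 * f 1 * f 2 := by
  rw [← Fin.prod_univ_three, ← Finset.prod_pair hij]
  exact Finset.prod_dvd_prod_of_subset _ _ _ (Finset.subset_univ _)

/-- The integral points of the universal torsor, normalised by `0 < u 2`. -/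
structure IsTorsorPoint (v : ℤ) (s u y : Fin 3 → ℤ) : Prop where
  v_pos : 0 < v
  s_pos : ∀ i, 0 < s i
  y_pos : ∀ i, 0 < y i
  u_pos : 0 < u 2
  sum_eq : ∑ i, s i * u i * y i ^ 2 = 0
  squarefree : Squarefree (u 0 * u 1 * u 2)
  gcd_s : Int.gcd (s 0 * s 1 * s 2) (u 0 * u 1 * u 2 * v) = 1
  gcd_y : ∀ i j, i ≠ j → Int.gcd (y i) (y j) = 1
  gcd_y0 : Int.gcd (y 0) (Int.gcd (s 1) (s 2)) = 1
  gcd_y1 : Int.gcd (y 1) (Int.gcd (s 0) (s 2)) = 1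
  gcd_y2 : Int.gcd (y 2) (Int.gcd (s 0) (s 1)) = 1

/-- For `i = 0, 1` these are the coordinates `t₁, t₂` of the image on the cubic surface of a point
of the torsor, and for `i = 2` it is `-(t₁ + t₂)`. -/
def torsorCoord (v : ℤ) (s u y : Fin 3 → ℤ) (i : Fin 3) : ℤ :=
  u 0 * u 1 * u 2 * v ^ 2 * s i * u i * y i ^ 2

namespace IsTorsorPoint

variable {v : ℤ} {s u y : Fin 3 → ℤ} {i j k : Fin 3}

theorem add_add_eq_zero (h : IsTorsorPoint v s u y) (hij : i ≠ j) (hik : i ≠ k) (hjk : j ≠ k) :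
    s i * u i * y i ^ 2 + s j * u j * y j ^ 2 + s k * u k * y k ^ 2 = 0 := by
  have := h.sum_eq
  rw [Fin.sum_univ_three] at this
  fin_cases i <;> fin_cases j <;> fin_cases k <;> simp_all <;> linarith

theorem gcd_y_gcd (h : IsTorsorPoint v s u y) (hij : i ≠ j) (hik : i ≠ k) (hjk : j ≠ k) :
    Int.gcd (y i) (Int.gcd (s j) (s k)) = 1 := by
  have h0 := h.gcd_y0
  have h1 := h.gcd_y1
  have h2 := h.gcd_y2
  have h0' := h0
  have h1' := h1
  have h2' := h2
  rw [Int.gcd_comm (s _)] at h0' h1' h2'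
  fin_cases i <;> fin_cases j <;> fin_cases k <;> first | assumption | simp at hij hik hjk

theorem squarefree_u (h : IsTorsorPoint v s u y) (i : Fin 3) : Squarefree (u i) :=
  h.squarefree.squarefree_of_dvd (Fin.dvd_mul_mul u i)

theorem isCoprime_u (h : IsTorsorPoint v s u y) (hij : i ≠ j) : IsCoprime (u i) (u j) :=
  (squarefree_mul_iff.1 (h.squarefree.squarefree_of_dvd (Fin.mul_dvd_mul_mul u hij))).1.isCoprime

theorem isCoprime_s_uv (h : IsTorsorPoint v s u y) (i : Fin 3) :
    IsCoprime (s i) (u 0 * u 1 * u 2 * v) :=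
  (Int.isCoprime_iff_gcd_eq_one.2 h.gcd_s).of_isCoprime_of_dvd_left (Fin.dvd_mul_mul s i)

theorem isCoprime_s_u (h : IsTorsorPoint v s u y) (i j : Fin 3) : IsCoprime (s i) (u j) :=
  (h.isCoprime_s_uv i).of_isCoprime_of_dvd_right ((Fin.dvd_mul_mul u j).mul_right v)

theorem isCoprime_y (h : IsTorsorPoint v s u y) (hij : i ≠ j) : IsCoprime (y i) (y j) :=
  Int.isCoprime_iff_gcd_eq_one.2 (h.gcd_y i j hij)

theorem isCoprime_y_su (h : IsTorsorPoint v s u y) (hij : i ≠ j) :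
    IsCoprime (y i) (s j * u j) := by
  obtain ⟨k, hik, hjk⟩ : ∃ k, i ≠ k ∧ j ≠ k := by revert i j; decide
  have hsum := h.add_add_eq_zero hij hik hjk
  refine isCoprime_of_prime_dvd (fun h0 => (h.y_pos i).ne' h0.1) fun p hp hpy hpsu => ?_
  have hpk : p ∣ s k * u k * y k ^ 2 := by
    rw [show s k * u k * y k ^ 2 = -(y i * (s i * u i * y i) + s j * u j * y j ^ 2) by
      linear_combination hsum]
    exact (dvd_add (hpy.mul_right _) (hpsu.mul_right _)).neg_right
  have hpyk : ¬ p ∣ y k := fun hk => hp.not_isUnit ((h.isCoprime_y hik).isUnit_of_dvd' hpy hk)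
  have hpsuk : p ∣ s k ∨ p ∣ u k :=
    (hp.dvd_or_dvd hpk).elim hp.dvd_or_dvd fun h' => absurd (hp.dvd_of_dvd_pow h') hpyk
  rcases hp.dvd_or_dvd hpsu with hj | hj <;> rcases hpsuk with hk | hk
  · have := Int.isCoprime_iff_gcd_eq_one.2 (h.gcd_y_gcd hij hik hjk)
    exact hp.not_isUnit (this.isUnit_of_dvd' hpy (Int.dvd_coe_gcd hj hk))
  · exact hp.not_isUnit ((h.isCoprime_s_u j k).isUnit_of_dvd' hj hk)
  · exact hp.not_isUnit ((h.isCoprime_s_u k j).isUnit_of_dvd' hk hj)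
  · exact hp.not_isUnit ((h.isCoprime_u hjk).isUnit_of_dvd' hj hk)

theorem eq_gcd_s (h : IsTorsorPoint v s u y) (i : Fin 3) :
    s i = Int.gcd (torsorCoord v s u y i) (s 0 * s 1 * s 2) := by
  have key : ∀ j, i ≠ j → IsCoprime (u 0 * u 1 * u 2 * v ^ 2 * u i * y i ^ 2) (s j) := by
    intro j hij
    have h1 := (h.isCoprime_s_uv j).symm
    rw [IsCoprime.mul_left_iff] at h1
    exact ((h1.1.mul_left h1.2.pow_left).mul_left (h.isCoprime_s_u j i).symm).mul_left
      ((h.isCoprime_y_su hij).of_mul_right_left.pow_left)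
  have aux : ∀ {r m : ℤ}, IsCoprime r m → s i = Int.gcd (s i * r) (s i * m) := by
    intro r m hrm
    rw [Int.gcd_mul_left, Int.isCoprime_iff_gcd_eq_one.1 hrm, mul_one,
      Int.natAbs_of_nonneg (h.s_pos i).le]
  obtain ⟨j, k, hij, hik, hjk, hs⟩ :
      ∃ j k, i ≠ j ∧ i ≠ k ∧ j ≠ k ∧ s 0 * s 1 * s 2 = s i * (s j * s k) := by
    fin_cases i
    exacts [⟨1, 2, by decide, by decide, by decide, by simp; ring⟩,
      ⟨0, 2, by decide, by decide, by decide, by simp; ring⟩,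
      ⟨0, 1, by decide, by decide, by decide, by simp; ring⟩]
  rw [hs, show torsorCoord v s u y i = s i * (u 0 * u 1 * u 2 * v ^ 2 * u i * y i ^ 2) by
    unfold torsorCoord; ring]
  exact aux ((key j hij).mul_right (key k hik))

theorem gcd_mul_uy_sq (h : IsTorsorPoint v s u y) (m : ℤ) :
    Int.gcd (m * (u 0 * y 0 ^ 2)) (m * (u 1 * y 1 ^ 2)) = m.natAbs := by
  have h01 : (0 : Fin 3) ≠ 1 := by decide
  have : IsCoprime (u 0 * y 0 ^ 2) (u 1 * y 1 ^ 2) :=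
    ((h.isCoprime_u h01).mul_right
      (h.isCoprime_y_su h01.symm).of_mul_right_right.symm.pow_right).mul_left
      ((h.isCoprime_y_su h01).of_mul_right_right.mul_right (h.isCoprime_y h01).pow_right).pow_left
  rw [Int.gcd_mul_left, Int.isCoprime_iff_gcd_eq_one.1 this, mul_one]

theorem sum_torsorCoord (h : IsTorsorPoint v s u y) :
    torsorCoord v s u y 0 + torsorCoord v s u y 1 + torsorCoord v s u y 2 = 0 := by
  have := h.sum_eq
  rw [Fin.sum_univ_three] at this
  unfold torsorCoord
  linear_combination (u 0 * u 1 * u 2 * v ^ 2) * this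

end IsTorsorPoint

theorem Int.natAbs_eq_and_eq_of_squarefree_mul_sq_eq {a b x y : ℤ} (ha : Squarefree a)
    (hb : Squarefree b) (hx : 0 < x) (hy : 0 < y)
    (h : a.natAbs * x.natAbs ^ 2 = b.natAbs * y.natAbs ^ 2) :
    a.natAbs = b.natAbs ∧ x = y := by
  have := Nat.eq_and_eq_of_squarefree_mul_sq_eq (Int.squarefree_natAbs.2 ha)
    (Int.squarefree_natAbs.2 hb) (Int.natAbs_pos.2 hx.ne') (Int.natAbs_pos.2 hy.ne') h
  exact ⟨this.1, by omega⟩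

theorem IsTorsorPoint.ext_of_torsorCoord {v v' : ℤ} {s s' u u' y y' : Fin 3 → ℤ}
    (h : IsTorsorPoint v s u y) (h' : IsTorsorPoint v' s' u' y')
    (h0 : torsorCoord v s u y 0 = torsorCoord v' s' u' y' 0)
    (h1 : torsorCoord v s u y 1 = torsorCoord v' s' u' y' 1)
    (hs : s 0 * s 1 * s 2 = s' 0 * s' 1 * s' 2) : v = v' ∧ s = s' ∧ u = u' ∧ y = y' := by
  have hc : ∀ i, torsorCoord v s u y i = torsorCoord v' s' u' y' i := by
    have h2 : torsorCoord v s u y 2 = torsorCoord v' s' u' y' 2 := by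
      linear_combination h.sum_torsorCoord - h'.sum_torsorCoord - h0 - h1
    intro i
    fin_cases i
    exacts [h0, h1, h2]
  obtain rfl : s = s' := by
    funext i
    rw [h.eq_gcd_s i, h'.eq_gcd_s i, hc i, hs]
  have hr : ∀ i, u 0 * u 1 * u 2 * v ^ 2 * (u i * y i ^ 2) =
      u' 0 * u' 1 * u' 2 * v' ^ 2 * (u' i * y' i ^ 2) := by
    intro i
    have := hc i
    unfold torsorCoord at this
    exact mul_left_cancel₀ (h.s_pos i).ne' (by linear_combination this)
  have hUv : (u 0 * u 1 * u 2 * v ^ 2).natAbs = (u' 0 * u' 1 * u' 2 * v' ^ 2).natAbs := by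
    rw [← h.gcd_mul_uy_sq, ← h'.gcd_mul_uy_sq, hr 0, hr 1]
  obtain ⟨-, rfl⟩ := Int.natAbs_eq_and_eq_of_squarefree_mul_sq_eq h.squarefree h'.squarefree
    h.v_pos h'.v_pos
    (by rwa [Int.natAbs_mul, Int.natAbs_mul _ (v' ^ 2), Int.natAbs_pow, Int.natAbs_pow] at hUv)
  have huy : ∀ i, (u i).natAbs = (u' i).natAbs ∧ y i = y' i := by
    intro i
    refine Int.natAbs_eq_and_eq_of_squarefree_mul_sq_eq (h.squarefree_u i) (h'.squarefree_u i)
      (h.y_pos i) (h'.y_pos i) ?_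
    have := congrArg Int.natAbs (hr i)
    rw [Int.natAbs_mul, Int.natAbs_mul _ (u' i * _), hUv] at this
    have := Nat.eq_of_mul_eq_mul_left (Int.natAbs_pos.2
      (mul_ne_zero h'.squarefree.ne_zero (pow_ne_zero 2 h'.v_pos.ne'))) this
    rwa [Int.natAbs_mul, Int.natAbs_mul, Int.natAbs_pow, Int.natAbs_pow] at this
  obtain rfl : y = y' := funext fun i => (huy i).2
  have hu : ∀ i, u 0 * u 1 * u 2 * u i = u' 0 * u' 1 * u' 2 * u' i := fun i =>
    mul_right_cancel₀ (mul_pos (pow_pos h.v_pos 2) (pow_pos (h.y_pos i) 2)).ne'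
      (by linear_combination hr i)
  have hu2 : u 2 = u' 2 := by
    have := (huy 2).1
    have := h.u_pos
    have := h'.u_pos
    omega
  have hU : u 0 * u 1 * u 2 = u' 0 * u' 1 * u' 2 :=
    mul_right_cancel₀ h'.u_pos.ne' (by rw [← hu 2, hu2])
  refine ⟨rfl, rfl, funext fun i => ?_, rfl⟩
  exact mul_left_cancel₀ h'.squarefree.ne_zero (by rw [← hu i, hU])

theorem exists_isTorsorPoint {a₀ a₁ t n : ℤ} (ht : 0 < t) (hn : 0 < n)
    (h : a₀ * a₁ * (a₀ + a₁) = -(t ^ 2 * n))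
    (hp : ∀ p : ℕ, p.Prime → (p : ℤ) ∣ a₀ → (p : ℤ) ∣ a₁ → (p : ℤ) ∣ t → (p : ℤ) ∣ n → False) :
    ∃ v s u y, IsTorsorPoint v s u y ∧ torsorCoord v s u y 0 = a₀ ∧ torsorCoord v s u y 1 = a₁ ∧
      (u 0 * u 1 * u 2) ^ 2 * v ^ 3 * (y 0 * y 1 * y 2) = t ∧ s 0 * s 1 * s 2 = n := by
  lift t to ℕ using ht.le
  lift n to ℕ using hn.le
  have ha : a₀ ≠ 0 ∨ a₁ ≠ 0 := by
    by_contra! ha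
    have : 0 < (t : ℤ) ^ 2 * n := by positivity
    simp only [ha.1, zero_mul] at h
    omega
  obtain ⟨d, c₀, c₁, hd, hc, rfl, rfl⟩ : ∃ (d : ℕ) (c₀ c₁ : ℤ), 0 < d ∧ IsCoprime c₀ c₁ ∧
      a₀ = d * c₀ ∧ a₁ = d * c₁ := by
    have hg : 0 < Int.gcd a₀ a₁ := Int.gcd_pos_iff.2 ha
    obtain ⟨c₀, c₁, hc, h₀, h₁⟩ := Int.exists_gcd_one hg
    exact ⟨_, c₀, c₁, hg, Int.isCoprime_iff_gcd_eq_one.2 hc, by rw [mul_comm]; exact h₀,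
      by rw [mul_comm]; exact h₁⟩
  have hcpos : (0 : ℤ) < c₀ * c₁ * -(c₀ + c₁) := by
    have : (0 : ℤ) < d ^ 3 * (c₀ * c₁ * -(c₀ + c₁)) := by
      rw [show (d : ℤ) ^ 3 * (c₀ * c₁ * -(c₀ + c₁)) = t ^ 2 * n by linear_combination -h]
      positivity
    exact pos_of_mul_pos_right this (by positivity)
  have hc₀ : c₀ ≠ 0 := by rintro rfl; simp at hcpos
  have hc₁ : c₁ ≠ 0 := by rintro rfl; simp at hcpos
  have hcop : ∀ {a b : ℤ}, IsCoprime a b → a.natAbs.Coprime b.natAbs := fun hab =>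
    Int.isCoprime_iff_gcd_eq_one.1 hab
  have hnat : d ^ 3 * (c₀.natAbs * c₁.natAbs * (-(c₀ + c₁)).natAbs) = t ^ 2 * n := by
    zify
    rw [← abs_mul, ← abs_mul, abs_of_pos hcpos]
    linear_combination -h
  obtain ⟨v, s₁, s₂, s₃, u₁, u₂, u₃, y₁, y₂, y₃, e₁, e₂, e₃, rfl, rfl, hsq, hsu, h₁₂, h₁₃, h₂₃,
      g₁, g₂, g₃⟩ := Nat.exists_torsor_coordinates (hcop hc)
    (hcop (by simpa [add_comm] using (hc.add_mul_left_right 1).neg_right))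
    (hcop (by simpa using (hc.symm.add_mul_left_right 1).neg_right))
    (by exact_mod_cast ht) (by exact_mod_cast hn) hnat
    fun p hpp hpd hpt hpn => hp p hpp ((Int.natCast_dvd_natCast.2 hpd).mul_right _)
      ((Int.natCast_dvd_natCast.2 hpd).mul_right _) (Int.natCast_dvd_natCast.2 hpt)
      (Int.natCast_dvd_natCast.2 hpn)
  have hσ₀ : c₀.sign ^ 2 = 1 := by
    rw [sq, ← Int.sign_mul, Int.sign_eq_one_of_pos (mul_self_pos.2 hc₀)]
  have hσ₁ : c₁.sign ^ 2 = 1 := by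
    rw [sq, ← Int.sign_mul, Int.sign_eq_one_of_pos (mul_self_pos.2 hc₁)]
  have hσ : c₀.sign * c₁.sign * (-(c₀ + c₁)).sign = 1 := by
    rw [← Int.sign_mul, ← Int.sign_mul, Int.sign_eq_one_of_pos hcpos]
  have hc₀' := Int.sign_mul_natAbs c₀
  have hc₁' := Int.sign_mul_natAbs c₁
  have hc₂' := Int.sign_mul_natAbs (-(c₀ + c₁))
  generalize c₀.natAbs = b₀, c₁.natAbs = b₁, (-(c₀ + c₁)).natAbs = b₂ at *
  generalize c₀.sign = σ₀, c₁.sign = σ₁, (-(c₀ + c₁)).sign = σ₂ at *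
  zify at e₁ e₂ e₃
  push_cast at ht hn h
  have hv : 0 < v := Nat.pos_of_ne_zero (by rintro rfl; simp at ht)
  have hy₁ : 0 < y₁ := Nat.pos_of_ne_zero (by rintro rfl; simp at ht)
  have hy₂ : 0 < y₂ := Nat.pos_of_ne_zero (by rintro rfl; simp at ht)
  have hy₃ : 0 < y₃ := Nat.pos_of_ne_zero (by rintro rfl; simp at ht)
  have hu₁ : 0 < u₁ := Nat.pos_of_ne_zero (by rintro rfl; simp at ht)
  have hu₂ : 0 < u₂ := Nat.pos_of_ne_zero (by rintro rfl; simp at ht)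
  have hu₃ : 0 < u₃ := Nat.pos_of_ne_zero (by rintro rfl; simp at ht)
  have hs₁ : 0 < s₁ := Nat.pos_of_ne_zero (by rintro rfl; simp at hn)
  have hs₂ : 0 < s₂ := Nat.pos_of_ne_zero (by rintro rfl; simp at hn)
  have hs₃ : 0 < s₃ := Nat.pos_of_ne_zero (by rintro rfl; simp at hn)
  have hUabs : (σ₁ * u₁ * (σ₀ * u₂) * u₃).natAbs = u₁ * u₂ * u₃ := by
    have h₀ : σ₀.natAbs = 1 := Int.isUnit_iff_natAbs_eq.1 (IsUnit.of_pow_eq_one hσ₀ two_ne_zero)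
    have h₁ : σ₁.natAbs = 1 := Int.isUnit_iff_natAbs_eq.1 (IsUnit.of_pow_eq_one hσ₁ two_ne_zero)
    simp [Int.natAbs_mul, h₀, h₁]
  have hC₀ : torsorCoord v ![s₁, s₂, s₃] ![σ₁ * u₁, σ₀ * u₂, u₃] ![y₁, y₂, y₃] 0 = d * c₀ := by
    simp only [torsorCoord, Matrix.cons_val]
    linear_combination (-σ₀) * e₁ + d * hc₀' + σ₀ * u₁ ^ 2 * u₂ * u₃ * v ^ 2 * s₁ * y₁ ^ 2 * hσ₁
  have hC₁ : torsorCoord v ![s₁, s₂, s₃] ![σ₁ * u₁, σ₀ * u₂, u₃] ![y₁, y₂, y₃] 1 = d * c₁ := by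
    simp only [torsorCoord, Matrix.cons_val]
    linear_combination (-σ₁) * e₂ + d * hc₁' + σ₁ * u₁ * u₂ ^ 2 * u₃ * v ^ 2 * s₂ * y₂ ^ 2 * hσ₀
  refine ⟨v, ![s₁, s₂, s₃], ![σ₁ * u₁, σ₀ * u₂, u₃], ![y₁, y₂, y₃],
    ⟨by exact_mod_cast hv, ?_, ?_, ?_, ?_, ?_, ?_, ?_, ?_, ?_, ?_⟩, hC₀, hC₁, ?_, ?_⟩
  · simp [Fin.forall_fin_succ, *]
  · simp [Fin.forall_fin_succ, *]
  · simpa using hu₃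
  · have hm : (u₁ * u₂ * u₃ * v ^ 2 : ℤ) ≠ 0 := by positivity
    simp only [Fin.sum_univ_three, Matrix.cons_val]
    apply mul_left_cancel₀ hm
    linear_combination (-σ₁) * e₁ - σ₀ * e₂ - e₃ + d * σ₀ * σ₁ * (hc₀' + hc₁' + hc₂')
      - d * b₂ * hσ - σ₁ * d * b₀ * hσ₀ - σ₀ * d * b₁ * hσ₁
  · simp only [Matrix.cons_val]
    rw [← Int.squarefree_natAbs, hUabs]
    exact hsq
  · simp only [Matrix.cons_val]
    rw [Int.gcd_def, Int.natAbs_mul _ (v : ℤ), hUabs]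
    exact_mod_cast hsu
  · intro i j hij
    fin_cases i <;> fin_cases j <;> first
      | exact absurd rfl hij
      | exact h₁₂
      | exact h₁₂.symm
      | exact h₁₃
      | exact h₁₃.symm
      | exact h₂₃
      | exact h₂₃.symm
  · exact_mod_cast g₁
  · exact_mod_cast g₂
  · exact_mod_cast g₃
  · simp only [Matrix.cons_val]
    push_cast
    linear_combination (u₁ * u₂ * u₃) ^ 2 * v ^ 3 * (y₁ * y₂ * y₃) * (σ₁ ^ 2 * hσ₀ + hσ₁)
  · simp

theorem IsTorsorPoint.torsorCoord_mul {v : ℤ} {s u y : Fin 3 → ℤ} (h : IsTorsorPoint v s u y) :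
    torsorCoord v s u y 0 * torsorCoord v s u y 1 *
        (torsorCoord v s u y 0 + torsorCoord v s u y 1) =
      -(((u 0 * u 1 * u 2) ^ 2 * v ^ 3 * (y 0 * y 1 * y 2)) ^ 2 * (s 0 * s 1 * s 2)) := by
  rw [eq_neg_of_add_eq_zero_left h.sum_torsorCoord]
  unfold torsorCoord
  ring

theorem IsTorsorPoint.not_prime_dvd {v : ℤ} {s u y : Fin 3 → ℤ} (h : IsTorsorPoint v s u y)
    {p : ℤ} (hp : Prime p) (h0 : p ∣ torsorCoord v s u y 0) (h1 : p ∣ torsorCoord v s u y 1)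
    (ht : p ∣ (u 0 * u 1 * u 2) ^ 2 * v ^ 3 * (y 0 * y 1 * y 2)) : ¬ p ∣ s 0 * s 1 * s 2 := by
  intro hs
  have hUv : ¬ p ∣ u 0 * u 1 * u 2 * v := fun hd =>
    hp.not_isUnit ((Int.isCoprime_iff_gcd_eq_one.2 h.gcd_s).isUnit_of_dvd' hs hd)
  have hU : ¬ p ∣ u 0 * u 1 * u 2 := fun hd => hUv (hd.mul_right v)
  have hv : ¬ p ∣ v := fun hd => hUv (hd.mul_left _)
  have hc : ∀ j, p ∣ torsorCoord v s u y j := by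
    have h2 : p ∣ torsorCoord v s u y 2 := by
      rw [eq_neg_of_add_eq_zero_right h.sum_torsorCoord]
      exact (dvd_add h0 h1).neg_right
    intro j
    fin_cases j
    exacts [h0, h1, h2]
  have hsy : ∀ j, p ∣ s j ∨ p ∣ y j := by
    intro j
    have hu : ¬ p ∣ u j := fun hd => hU (hd.trans (Fin.dvd_mul_mul u j))
    rcases hp.dvd_or_dvd (hc j) with hd | hd
    · exact .inl (((hp.dvd_or_dvd hd).resolve_right hu |> hp.dvd_or_dvd).resolve_left fun hd =>
        (hp.dvd_or_dvd hd).elim hU fun hd => hv (hp.dvd_of_dvd_pow hd))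
    · exact .inr (hp.dvd_of_dvd_pow hd)
  obtain ⟨i, hi⟩ : ∃ i, p ∣ y i := by
    rcases hp.dvd_or_dvd ht with hd | hd
    · exact absurd hd fun hd => (hp.dvd_or_dvd hd).elim (fun hd => hU (hp.dvd_of_dvd_pow hd))
        fun hd => hv (hp.dvd_of_dvd_pow hd)
    · rcases hp.dvd_or_dvd hd with hd | hd
      · exact (hp.dvd_or_dvd hd).elim (⟨0, ·⟩) (⟨1, ·⟩)
      · exact ⟨2, hd⟩
  have hsi : ∀ j, i ≠ j → p ∣ s j := fun j hij => (hsy j).resolve_right fun hj =>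
    hp.not_isUnit ((h.isCoprime_y hij).isUnit_of_dvd' hi hj)
  obtain ⟨j, k, hij, hik, hjk⟩ : ∃ j k, i ≠ j ∧ i ≠ k ∧ j ≠ k := by
    clear hi hsi
    revert i
    decide
  exact hp.not_isUnit ((Int.isCoprime_iff_gcd_eq_one.2 (h.gcd_y_gcd hij hik hjk)).isUnit_of_dvd' hi
    (Int.dvd_coe_gcd (hsi j hij) (hsi k hik)))

theorem Finset.gcd_natAbs_eq_one_iff {ι : Type*} (s : Finset ι) (t : ι → ℤ) :
    s.gcd (fun i => (t i).natAbs) = 1 ↔ ∀ p : ℕ, p.Prime → ¬ ∀ i ∈ s, (p : ℤ) ∣ t i := by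
  simp only [Nat.eq_one_iff_not_exists_prime_dvd, Finset.dvd_gcd_iff, Int.natCast_dvd]

/-- The primitive vectors of height at most `B` on the surface, off the lines. -/
def surfacePoints (B : ℝ) : Set (Fin 4 → ℤ) :=
  {t | Finset.gcd Finset.univ (fun i => (t i).natAbs) = 1 ∧
    (∀ i, |(t i : ℝ)| ≤ B) ∧
    t 0 * t 1 * (t 0 + t 1) = t 2 ^ 2 * t 3 ∧
    t 2 * t 3 ≠ 0}

/-- The points of the torsor whose image on the surface has height at most `B`. -/
def torsorPoints (B : ℝ) : Set (ℤ × (Fin 3 → ℤ) × (Fin 3 → ℤ) × (Fin 3 → ℤ)) :=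
  {w | IsTorsorPoint w.1 w.2.1 w.2.2.1 w.2.2.2 ∧
    |(torsorCoord w.1 w.2.1 w.2.2.1 w.2.2.2 0 : ℝ)| ≤ B ∧
    |(torsorCoord w.1 w.2.1 w.2.2.1 w.2.2.2 1 : ℝ)| ≤ B ∧
    |(((w.2.2.1 0 * w.2.2.1 1 * w.2.2.1 2) ^ 2 * w.1 ^ 3 *
      (w.2.2.2 0 * w.2.2.2 1 * w.2.2.2 2) : ℤ) : ℝ)| ≤ B ∧
    |((w.2.1 0 * w.2.1 1 * w.2.1 2 : ℤ) : ℝ)| ≤ B}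

/-- The image of a point of the torsor on the surface, twisted by two signs. -/
def torsorToSurface (w : (ℤ × (Fin 3 → ℤ) × (Fin 3 → ℤ) × (Fin 3 → ℤ)) × ℤˣ × ℤˣ) : Fin 4 → ℤ :=
  ![w.2.1 * torsorCoord w.1.1 w.1.2.1 w.1.2.2.1 w.1.2.2.2 0,
    w.2.1 * torsorCoord w.1.1 w.1.2.1 w.1.2.2.1 w.1.2.2.2 1,
    w.2.2 * ((w.1.2.2.1 0 * w.1.2.2.1 1 * w.1.2.2.1 2) ^ 2 * w.1.1 ^ 3 *
      (w.1.2.2.2 0 * w.1.2.2.2 1 * w.1.2.2.2 2)),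
    -(w.2.1 * (w.1.2.1 0 * w.1.2.1 1 * w.1.2.1 2))]

theorem Int.units_coe_sq (ε : ℤˣ) : (ε : ℤ) ^ 2 = 1 := by
  rw [← Units.val_pow_eq_pow_val, Int.units_sq, Units.val_one]

theorem Int.units_abs_cast_mul (ε : ℤˣ) (a : ℤ) : |(((ε : ℤ) * a : ℤ) : ℝ)| = |(a : ℝ)| := by
  rcases Int.units_eq_one_or ε with rfl | rfl <;> simp

theorem Int.units_eq_and_eq_of_pos {ε ε' : ℤˣ} {a a' : ℤ} (ha : 0 < a) (ha' : 0 < a')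
    (h : (ε : ℤ) * a = ε' * a') : ε = ε' ∧ a = a' := by
  rcases Int.units_eq_one_or ε with rfl | rfl <;>
    rcases Int.units_eq_one_or ε' with rfl | rfl <;> simp at h ⊢ <;> omega

theorem Int.exists_units_mul_pos {a : ℤ} (ha : a ≠ 0) : ∃ (ε : ℤˣ) (b : ℤ), 0 < b ∧ a = ε * b := by
  rcases ha.lt_or_gt with h | h
  · exact ⟨-1, -a, by omega, by simp⟩
  · exact ⟨1, a, h, by simp⟩

theorem IsTorsorPoint.prod_s_pos {v : ℤ} {s u y : Fin 3 → ℤ} (h : IsTorsorPoint v s u y) :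
    0 < s 0 * s 1 * s 2 :=
  mul_pos (mul_pos (h.s_pos 0) (h.s_pos 1)) (h.s_pos 2)

theorem IsTorsorPoint.third_coord_pos {v : ℤ} {s u y : Fin 3 → ℤ} (h : IsTorsorPoint v s u y) :
    0 < (u 0 * u 1 * u 2) ^ 2 * v ^ 3 * (y 0 * y 1 * y 2) :=
  mul_pos (mul_pos (sq_pos_of_ne_zero h.squarefree.ne_zero) (pow_pos h.v_pos 3))
    (mul_pos (mul_pos (h.y_pos 0) (h.y_pos 1)) (h.y_pos 2))

theorem torsorToSurface_bijOn (B : ℝ) :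
    Set.BijOn torsorToSurface (torsorPoints B ×ˢ Set.univ) (surfacePoints B) := by
  refine ⟨?_, ?_, ?_⟩
  · rintro ⟨⟨v, s, u, y⟩, ε, δ⟩ ⟨⟨h, hB₀, hB₁, hB₂, hB₃⟩, -⟩
    dsimp only at h hB₀ hB₁ hB₂ hB₃
    have hε : (ε : ℤ) ^ 2 = 1 := Int.units_coe_sq ε
    have hδ : (δ : ℤ) ^ 2 = 1 := Int.units_coe_sq δ
    refine ⟨?_, ?_, ?_, ?_⟩
    · rw [Finset.gcd_natAbs_eq_one_iff]
      intro p hp hd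
      have hd₀ := hd 0 (Finset.mem_univ _)
      have hd₁ := hd 1 (Finset.mem_univ _)
      have hd₂ := hd 2 (Finset.mem_univ _)
      have hd₃ := hd 3 (Finset.mem_univ _)
      simp only [torsorToSurface, Matrix.cons_val, Units.dvd_mul_left, Int.dvd_neg]
        at hd₀ hd₁ hd₂ hd₃
      exact h.not_prime_dvd (Nat.prime_iff_prime_int.1 hp) hd₀ hd₁ hd₂ hd₃
    · intro i
      fin_cases i
      · exact (Int.units_abs_cast_mul ε _).trans_le hB₀
      · exact (Int.units_abs_cast_mul ε _).trans_le hB₁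
      · exact (Int.units_abs_cast_mul δ _).trans_le hB₂
      · change |((-(ε * (s 0 * s 1 * s 2)) : ℤ) : ℝ)| ≤ B
        rwa [Int.cast_neg, abs_neg, Int.units_abs_cast_mul]
    · simp only [torsorToSurface, Matrix.cons_val]
      linear_combination (ε : ℤ) ^ 3 * h.torsorCoord_mul -
        ((u 0 * u 1 * u 2) ^ 2 * v ^ 3 * (y 0 * y 1 * y 2)) ^ 2 * (s 0 * s 1 * s 2) *
          ε * (hε - hδ)
    · simp only [torsorToSurface, Matrix.cons_val]
      exact mul_ne_zero (mul_ne_zero δ.ne_zero h.third_coord_pos.ne')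
        (neg_ne_zero.2 (mul_ne_zero ε.ne_zero h.prod_s_pos.ne'))
  · rintro ⟨⟨v, s, u, y⟩, ε, δ⟩ ⟨⟨h, -⟩, -⟩ ⟨⟨v', s', u', y'⟩, ε', δ'⟩ ⟨⟨h', -⟩, -⟩ heq
    have e₀ := congrFun heq 0
    have e₁ := congrFun heq 1
    have e₂ := congrFun heq 2
    have e₃ := congrFun heq 3
    dsimp only at h h'
    simp only [torsorToSurface, Matrix.cons_val, neg_inj] at e₀ e₁ e₂ e₃
    obtain ⟨rfl, -⟩ := Int.units_eq_and_eq_of_pos h.third_coord_pos h'.third_coord_pos e₂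
    obtain ⟨rfl, hs⟩ := Int.units_eq_and_eq_of_pos h.prod_s_pos h'.prod_s_pos e₃
    obtain ⟨rfl, rfl, rfl, rfl⟩ := h.ext_of_torsorCoord h' (mul_left_cancel₀ ε.ne_zero e₀)
      (mul_left_cancel₀ ε.ne_zero e₁) hs
    rfl
  · rintro t ⟨hgcd, hB, heq, hne⟩
    obtain ⟨δ, a₂, ha₂, ht₂⟩ := Int.exists_units_mul_pos (left_ne_zero_of_mul hne)
    obtain ⟨ε, a₃, ha₃, ht₃⟩ := Int.exists_units_mul_pos (neg_ne_zero.2 (right_ne_zero_of_mul hne))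
    rw [Finset.gcd_natAbs_eq_one_iff] at hgcd
    have hε : (ε : ℤ) ^ 2 = 1 := Int.units_coe_sq ε
    have hδ : (δ : ℤ) ^ 2 = 1 := Int.units_coe_sq δ
    have hcubic : ε * t 0 * (ε * t 1) * (ε * t 0 + ε * t 1) = -(a₂ ^ 2 * a₃) := by
      rw [ht₂] at heq
      linear_combination (ε : ℤ) ^ 3 * heq - ε ^ 3 * (δ * a₂) ^ 2 * ht₃ -
        a₂ ^ 2 * a₃ * (δ ^ 2 * (ε ^ 2 + 1) * hε + hδ)
    obtain ⟨v, s, u, y, h, h₀, h₁, h₂, h₃⟩ := exists_isTorsorPoint ha₂ ha₃ hcubic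
      fun p hp hp₀ hp₁ hp₂ hp₃ => hgcd p hp fun i _ => by
        rw [Units.dvd_mul_left] at hp₀ hp₁
        rw [← Units.dvd_mul_left (u := δ), ← ht₂] at hp₂
        rw [← Units.dvd_mul_left (u := ε), ← ht₃, Int.dvd_neg] at hp₃
        fin_cases i
        exacts [hp₀, hp₁, hp₂, hp₃]
    refine ⟨⟨⟨v, s, u, y⟩, ε, δ⟩, ⟨⟨h, ?_, ?_, ?_, ?_⟩, trivial⟩, ?_⟩
    · simpa only [h₀, Int.units_abs_cast_mul] using hB 0
    · simpa only [h₁, Int.units_abs_cast_mul] using hB 1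
    · simpa only [h₂, ht₂, Int.units_abs_cast_mul] using hB 2
    · have := hB 3
      rw [← abs_neg, ← Int.cast_neg, ht₃, Int.units_abs_cast_mul] at this
      simpa only [h₃] using this
    · funext i
      fin_cases i
      · simp only [torsorToSurface, Fin.zero_eta, Matrix.cons_val, h₀]
        linear_combination t 0 * hε
      · simp only [torsorToSurface, Fin.mk_one, Matrix.cons_val, h₁]
        linear_combination t 1 * hε
      · simp only [torsorToSurface, Fin.reduceFinMk, Matrix.cons_val, h₂, ht₂]
      · simp only [torsorToSurface, Fin.reduceFinMk, Matrix.cons_val, h₃, ← ht₃, neg_neg]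

theorem card_surfacePoints (B : ℝ) :
    Nat.card (surfacePoints B) = Nat.card (torsorPoints B) * 4 := by
  rw [← Nat.card_congr (torsorToSurface_bijOn B).equiv,
    Nat.card_congr (Equiv.Set.prod _ _), Nat.card_prod,
    Nat.card_congr (Equiv.Set.univ (ℤˣ × ℤˣ)), Nat.card_prod, Nat.card_eq_fintype_card (α := ℤˣ),
    Fintype.card_units_int]


theorem stmt_19 (B : ℝ) (hB : 1 ≤ B) :
    (1 / 2 : ℝ) * (Nat.card {t : Fin 4 → ℤ //
        Finset.gcd Finset.univ (fun i => (t i).natAbs) = 1 ∧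
        (∀ i, |(t i : ℝ)| ≤ B) ∧
        t 0 * t 1 * (t 0 + t 1) = t 2 ^ 2 * t 3 ∧
        t 2 * t 3 ≠ 0} : ℝ)
      = 2 * (Nat.card {w : ℤ × (Fin 3 → ℤ) × (Fin 3 → ℤ) × (Fin 3 → ℤ) //
        0 < w.1 ∧ (∀ i, 0 < w.2.1 i) ∧ (∀ i, 0 < w.2.2.2 i) ∧ 0 < w.2.2.1 2 ∧
        max (max |((w.2.1 0 * w.2.1 1 * w.2.1 2 : ℤ) : ℝ)|
                 |((w.2.2.1 0 ^ 2 * w.2.2.1 1 ^ 2 * w.2.2.1 2 ^ 2 * w.1 ^ 3 *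
                     w.2.2.2 0 * w.2.2.2 1 * w.2.2.2 2 : ℤ) : ℝ)|)
            (max |((w.2.1 0 * w.2.2.1 0 ^ 2 * w.2.2.1 1 * w.2.2.1 2 * w.1 ^ 2 *
                     w.2.2.2 0 ^ 2 : ℤ) : ℝ)|
                 |((w.2.1 1 * w.2.2.1 0 * w.2.2.1 1 ^ 2 * w.2.2.1 2 * w.1 ^ 2 *
                     w.2.2.2 1 ^ 2 : ℤ) : ℝ)|) ≤ B ∧
        (∑ i, w.2.1 i * w.2.2.1 i * w.2.2.2 i ^ 2) = 0 ∧
        Squarefree (w.2.2.1 0 * w.2.2.1 1 * w.2.2.1 2) ∧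
        Int.gcd (w.2.1 0 * w.2.1 1 * w.2.1 2)
          (w.2.2.1 0 * w.2.2.1 1 * w.2.2.1 2 * w.1) = 1 ∧
        (∀ i j, i ≠ j → Int.gcd (w.2.2.2 i) (w.2.2.2 j) = 1) ∧
        Int.gcd (w.2.2.2 0) (Int.gcd (w.2.1 1) (w.2.1 2)) = 1 ∧
        Int.gcd (w.2.2.2 1) (Int.gcd (w.2.1 0) (w.2.1 2)) = 1 ∧
        Int.gcd (w.2.2.2 2) (Int.gcd (w.2.1 0) (w.2.1 1)) = 1} : ℝ) := by
  have hT := card_surfacePoints B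
  rw [Nat.card_congr (Equiv.subtypeEquivRight (q := (· ∈ torsorPoints B)) fun w => ?_)]
  · change (1 / 2 : ℝ) * (Nat.card (surfacePoints B) : ℝ) = 2 * (Nat.card (torsorPoints B) : ℝ)
    rw [hT]
    push_cast
    ring
  · obtain ⟨v, s, u, y⟩ := w
    have e₀ : torsorCoord v s u y 0 = s 0 * u 0 ^ 2 * u 1 * u 2 * v ^ 2 * y 0 ^ 2 := by
      unfold torsorCoord; ring
    have e₁ : torsorCoord v s u y 1 = s 1 * u 0 * u 1 ^ 2 * u 2 * v ^ 2 * y 1 ^ 2 := by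
      unfold torsorCoord; ring
    have e₂ : (u 0 * u 1 * u 2) ^ 2 * v ^ 3 * (y 0 * y 1 * y 2) =
        u 0 ^ 2 * u 1 ^ 2 * u 2 ^ 2 * v ^ 3 * y 0 * y 1 * y 2 := by ring
    simp only [torsorPoints, Set.mem_ofPred_eq, e₀, e₁, e₂, max_le_iff]
    constructor
    · rintro ⟨h₁, h₂, h₃, h₄, ⟨⟨b₁, b₂⟩, b₃, b₄⟩, h₅, h₆, h₇, h₈, h₉, h₁₀, h₁₁⟩
      exact ⟨⟨h₁, h₂, h₃, h₄, h₅, h₆, h₇, h₈, h₉, h₁₀, h₁₁⟩, b₃, b₄, b₂, b₁⟩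
    · rintro ⟨⟨h₁, h₂, h₃, h₄, h₅, h₆, h₇, h₈, h₉, h₁₀, h₁₁⟩, b₃, b₄, b₂, b₁⟩
      exact ⟨h₁, h₂, h₃, h₄, ⟨⟨b₁, b₂⟩, b₃, b₄⟩, h₅, h₆, h₇, h₈, h₉, h₁₀, h₁₁⟩
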